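/- If an oracle A ⊆ ℕ is meager engulfing, then A computes a weakly 1-generic element of Cantor space 2^ω. -/

import Mathlib

open Filter

namespace CichonAnalog

/-! ### Oracle computability -/

/-- Partial functions `ℕ →. ℕ` partial recursive relative to the oracle `A ⊆ ℕ`.
This is Mathlib's `Nat.Partrec` with an extra base case for the characteristic
function of the oracle. -/
inductive RecursiveIn (A : Set ℕ) : (ℕ →. ℕ) → Prop
  | zero : RecursiveIn A (pure 0)
  | succ : RecursiveIn A ↑Nat.succ
  | left : RecursiveIn A ↑fun n : ℕ => n.unpair.1
  | right : RecursiveIn A ↑fun n : ℕ => n.unpair.2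
  | oracle : RecursiveIn A ↑fun n : ℕ => A.indicator (fun _ => 1) n
  | pair {f g} : RecursiveIn A f → RecursiveIn A g →
      RecursiveIn A fun n => Nat.pair <$> f n <*> g n
  | comp {f g} : RecursiveIn A f → RecursiveIn A g →
      RecursiveIn A fun n => g n >>= f
  | prec {f g} : RecursiveIn A f → RecursiveIn A g →
      RecursiveIn A (Nat.unpaired fun a n =>
        n.rec (f a) fun y IH => do let i ← IH; g (Nat.pair a (Nat.pair y i)))
  | rfind {f} : RecursiveIn A f →
      RecursiveIn A fun a => Nat.rfind fun n => (fun m => m = 0) <$> f (Nat.pair a n)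

/-- The partial function `f` (between coded spaces) is partial recursive in the oracle `A`. -/
def PartrecIn (A : Set ℕ) {α σ : Type} [Primcodable α] [Primcodable σ] (f : α →. σ) : Prop :=
  RecursiveIn A fun n =>
    Part.bind ↑(Encodable.decode (α := α) n) fun a => (f a).map Encodable.encode

/-- `f ≤_T A` : the (total) function `f` is computable from the oracle `A`. -/
def ComputableIn (A : Set ℕ) {α σ : Type} [Primcodable α] [Primcodable σ] (f : α → σ) : Prop :=
  PartrecIn A (f : α →. σ)

/-- `W` is computably enumerable in the oracle `A`. -/
def CEIn (A : Set ℕ) {α : Type} [Primcodable α] (W : Set α) : Prop :=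
  ∃ f : α →. ℕ, PartrecIn A f ∧ ∀ a, a ∈ W ↔ (f a).Dom

/-- `W` is computably enumerable (unrelativized). -/
def CE {α : Type} [Primcodable α] (W : Set α) : Prop :=
  ∃ f : α →. ℕ, Partrec f ∧ ∀ a, a ∈ W ↔ (f a).Dom

/-! ### Cantor space, `Π⁰₁` classes, effective meagerness -/

/-- The basic clopen set (cylinder) of the finite binary string `σ` in Cantor space. -/
def Cyl (σ : List Bool) : Set (ℕ → Bool) :=
  {x | ∀ i, i < σ.length → x i = σ.getD i false}

/-- `P` is a `Π⁰₁(A)` class: a closed subset of Cantor space whose complement is the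
union of basic clopen sets over a set of strings c.e. in `A`. -/
def Pi01In (A : Set ℕ) (P : Set (ℕ → Bool)) : Prop :=
  ∃ W : Set (List Bool), CEIn A W ∧ P = (⋃ σ ∈ W, Cyl σ)ᶜ

/-- `P` is a (plain) `Π⁰₁` class. -/
def Pi01 (P : Set (ℕ → Bool)) : Prop :=
  ∃ W : Set (List Bool), CE W ∧ P = (⋃ σ ∈ W, Cyl σ)ᶜ

/-- `C` is a uniformly `Π⁰₁(A)` sequence of classes. -/
def UnifPi01In (A : Set ℕ) (C : ℕ → Set (ℕ → Bool)) : Prop :=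
  ∃ W : Set (ℕ × List Bool), CEIn A W ∧
    ∀ m, C m = (⋃ σ ∈ {s | (m, s) ∈ W}, Cyl σ)ᶜ

/-- `C` is a uniformly `Π⁰₁` sequence of classes. -/
def UnifPi01 (C : ℕ → Set (ℕ → Bool)) : Prop :=
  ∃ W : Set (ℕ × List Bool), CE W ∧
    ∀ m, C m = (⋃ σ ∈ {s | (m, s) ∈ W}, Cyl σ)ᶜ

/-- `S` is effectively meager relative to `A`: it is contained in the union of a
uniformly `Π⁰₁(A)` sequence of nowhere dense classes. -/
def EffMeagerIn (A : Set ℕ) (S : Set (ℕ → Bool)) : Prop :=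
  ∃ C : ℕ → Set (ℕ → Bool), UnifPi01In A C ∧ (∀ m, IsNowhereDense (C m)) ∧ S ⊆ ⋃ m, C m

/-- `S` is effectively meager (unrelativized). -/
def EffMeager (S : Set (ℕ → Bool)) : Prop :=
  ∃ C : ℕ → Set (ℕ → Bool), UnifPi01 C ∧ (∀ m, IsNowhereDense (C m)) ∧ S ⊆ ⋃ m, C m

/-- `A` is meager engulfing: some `A`-effectively meager set contains every
effectively meager set. -/
def MeagerEngulfing (A : Set ℕ) : Prop :=
  ∃ S, EffMeagerIn A S ∧ ∀ T, EffMeager T → T ⊆ S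

/-- `A` is weakly meager engulfing: some `A`-effectively meager set contains every
computable element of Cantor space. -/
def WeaklyMeagerEngulfing (A : Set ℕ) : Prop :=
  ∃ S, EffMeagerIn A S ∧ ∀ x : ℕ → Bool, Computable x → x ∈ S

/-- `V` is a computable set of finite binary strings. -/
def ComputableStringSet (V : Set (List Bool)) : Prop :=
  ∃ χ : List Bool → Bool, Computable χ ∧ ∀ s, s ∈ V ↔ χ s = true

/-- `V` is a dense set of finite binary strings: every string has an extension in `V`. -/
def DenseStringSet (V : Set (List Bool)) : Prop :=
  ∀ σ : List Bool, ∃ τ ∈ V, σ <+: τ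

/-- `x ∈ 2^ω` is weakly 1-generic: for every computable dense set `V` of finite
binary strings, some initial segment of `x` lies in `V`. -/
def Weakly1Generic (x : ℕ → Bool) : Prop :=
  ∀ V : Set (List Bool), ComputableStringSet V → DenseStringSet V →
    ∃ n, (List.ofFn fun i : Fin n => x i) ∈ V

/-! ### Domination properties -/

/-- `A` is high: `A` computes a function dominating every total computable function. -/
def High (A : Set ℕ) : Prop :=
  ∃ f : ℕ → ℕ, ComputableIn A f ∧
    ∀ g : ℕ → ℕ, Computable g → ∀ᶠ n in atTop, g n ≤ f n

/-- `A` is of hyperimmune degree: `A` computes a function not dominated by any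
computable function. -/
def HyperimmuneDegree (A : Set ℕ) : Prop :=
  ∃ f : ℕ → ℕ, ComputableIn A f ∧
    ∀ g : ℕ → ℕ, Computable g → ∃ᶠ n in atTop, g n < f n

/-- `A` is of hyperimmune-free degree: every function computable in `A` is dominated
by a total computable function. -/
def HyperimmuneFree (A : Set ℕ) : Prop :=
  ∀ f : ℕ → ℕ, ComputableIn A f →
    ∃ g : ℕ → ℕ, Computable g ∧ ∀ᶠ n in atTop, f n ≤ g n

/-! ### Measure on Cantor space, Kurtz and Schnorr tests -/

open scoped Classical in
/-- The uniform measure of the clopen set `⋃ σ ∈ F, [σ]` determined by the finite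
list `F` of binary strings: count the binary strings of maximal length extending
some member of `F`, and normalize. -/
noncomputable def listMeasure (F : List (List Bool)) : ℚ :=
  letI k := (F.map List.length).foldr max 0
  ((Finset.univ.filter fun v : Fin k → Bool =>
      ∃ σ ∈ F, σ <+: List.ofFn v).card : ℚ) / 2 ^ k

/-- The clopen subset of Cantor space given explicitly as a finite union of
basic clopen sets. -/
def ClopSet (F : List (List Bool)) : Set (ℕ → Bool) := ⋃ σ ∈ F, Cyl σ

/-- The effectively open subset of Cantor space enumerated by the sequence of
finite stages `g`. -/
def OpenSet (g : ℕ → List (List Bool)) : Set (ℕ → Bool) := ⋃ s, ClopSet (g s)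

/-- The measure of the open set enumerated by the stages `g`: the supremum of the
measures of its finite partial unions. -/
noncomputable def openMeasure (g : ℕ → List (List Bool)) : ℝ :=
  ⨆ s : ℕ, (listMeasure ((List.range (s + 1)).flatMap g) : ℝ)

/-- A Kurtz test relative to `A`: an `A`-computable sequence of explicitly given
clopen sets, the `m`-th of measure at most `2 ^ (-m)`. -/
def KurtzTestIn (A : Set ℕ) (G : ℕ → List (List Bool)) : Prop :=
  ComputableIn A G ∧ ∀ m, listMeasure (G m) ≤ (1 / 2) ^ m

/-- A (plain) Kurtz test. -/
def KurtzTest (G : ℕ → List (List Bool)) : Prop :=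
  Computable G ∧ ∀ m, listMeasure (G m) ≤ (1 / 2) ^ m

/-- A Schnorr test relative to `A`: an `A`-computable doubly indexed sequence of finite
stages such that the `m`-th effectively open set `⋃ s, ClopSet (g m s)` has measure at
most `2 ^ (-m)`, and this measure is a real computable in `A` uniformly in `m`. -/
def SchnorrTestIn (A : Set ℕ) (g : ℕ → ℕ → List (List Bool)) : Prop :=
  ComputableIn A (fun p : ℕ × ℕ => g p.1 p.2) ∧
  (∀ m, openMeasure (g m) ≤ (1 / 2) ^ m) ∧
  ∃ q : ℕ × ℕ → ℚ, ComputableIn A q ∧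
    ∀ m k, |openMeasure (g m) - (q (m, k) : ℝ)| ≤ (1 / 2) ^ k

/-- A (plain) Schnorr test. -/
def SchnorrTest (g : ℕ → ℕ → List (List Bool)) : Prop :=
  Computable (fun p : ℕ × ℕ => g p.1 p.2) ∧
  (∀ m, openMeasure (g m) ≤ (1 / 2) ^ m) ∧
  ∃ q : ℕ × ℕ → ℚ, Computable q ∧
    ∀ m k, |openMeasure (g m) - (q (m, k) : ℝ)| ≤ (1 / 2) ^ k

/-- `N` is Schnorr null relative to `A`. -/
def SchnorrNullIn (A : Set ℕ) (N : Set (ℕ → Bool)) : Prop :=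
  ∃ g, SchnorrTestIn A g ∧ N ⊆ ⋂ m, OpenSet (g m)

/-- `N` is Schnorr null (unrelativized). -/
def SchnorrNull (N : Set (ℕ → Bool)) : Prop :=
  ∃ g, SchnorrTest g ∧ N ⊆ ⋂ m, OpenSet (g m)

/-- `x ∈ 2^ω` is Schnorr random: it belongs to no Schnorr null set. -/
def SchnorrRandom (x : ℕ → Bool) : Prop := ∀ N, SchnorrNull N → x ∉ N

/-- `A` is Kurtz engulfing: there is an `A`-computable sequence of Kurtz tests relative
to `A` such that every Kurtz null set is contained in the null set of one of them. -/
def KurtzEngulfing (A : Set ℕ) : Prop :=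
  ∃ G : ℕ → ℕ → List (List Bool),
    ComputableIn A (fun p : ℕ × ℕ => G p.1 p.2) ∧
    (∀ i m, listMeasure (G i m) ≤ (1 / 2) ^ m) ∧
    ∀ L, KurtzTest L → ∃ i, (⋂ m, ClopSet (L m)) ⊆ ⋂ m, ClopSet (G i m)

/-- `A` is weakly Kurtz engulfing: there is an `A`-computable sequence of Kurtz tests
relative to `A` such that the union of their null sets contains every computable
element of Cantor space. -/
def WeaklyKurtzEngulfing (A : Set ℕ) : Prop :=
  ∃ G : ℕ → ℕ → List (List Bool),
    ComputableIn A (fun p : ℕ × ℕ => G p.1 p.2) ∧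
    (∀ i m, listMeasure (G i m) ≤ (1 / 2) ^ m) ∧
    ∀ x : ℕ → Bool, Computable x → ∃ i, x ∈ ⋂ m, ClopSet (G i m)

/-- `A` is weakly Schnorr engulfing: some set Schnorr null relative to `A` contains
every computable element of Cantor space. -/
def WeaklySchnorrEngulfing (A : Set ℕ) : Prop :=
  ∃ N, SchnorrNullIn A N ∧ ∀ x : ℕ → Bool, Computable x → x ∈ N

/-! ### DNR and PA degrees -/

/-- The `e`-th partial computable function. -/
noncomputable def phi (e : ℕ) : ℕ →. ℕ := (Denumerable.ofNat Nat.Partrec.Code e).eval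

/-- `h` is diagonally nonrecursive. -/
def DNRFun (h : ℕ → ℕ) : Prop := ∀ e, ∀ y ∈ phi e e, h e ≠ y

/-- `A` is DNR: `A` computes a diagonally nonrecursive function. -/
def DNRDegree (A : Set ℕ) : Prop := ∃ h : ℕ → ℕ, ComputableIn A h ∧ DNRFun h

/-- `A` is PA: `A` computes a `{0,1}`-valued diagonally nonrecursive function. -/
def PA (A : Set ℕ) : Prop :=
  ∃ h : ℕ → ℕ, ComputableIn A h ∧ (∀ e, h e ≤ 1) ∧ DNRFun h

/-! ### Traces -/

/-- The trace `σ` (satisfying `|σ n| ≤ n`) traces the function `f` if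
`f n ∈ σ n` for all but finitely many `n`. -/
def Traces (σ : ℕ → Finset ℕ) (f : ℕ → ℕ) : Prop := ∀ᶠ n in atTop, f n ∈ σ n

/-- `σ` is a `(D, g)`-trace relative to `A`: `D` is infinite and c.e. in `A`, `g` is a
partial `A`-computable function with `D ⊆ dom g` and `g n ≥ n` on its domain, and `σ`
is partial `A`-computable, defined on `D`, with `|σ n| < g n` for all `n ∈ D`. -/
def IsDGTraceIn (A : Set ℕ) (D : Set ℕ) (g : ℕ →. ℕ) (σ : ℕ →. Finset ℕ) : Prop :=
  D.Infinite ∧ CEIn A D ∧ PartrecIn A g ∧ D ⊆ g.Dom ∧ (∀ n, ∀ y ∈ g n, n ≤ y) ∧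
  PartrecIn A σ ∧ D ⊆ σ.Dom ∧ ∀ n ∈ D, ∀ S ∈ σ n, ∀ b ∈ g n, S.card < b

/-- `σ` is a `(D, g)`-trace (unrelativized). -/
def IsDGTrace (D : Set ℕ) (g : ℕ →. ℕ) (σ : ℕ →. Finset ℕ) : Prop :=
  D.Infinite ∧ CE D ∧ Partrec g ∧ D ⊆ g.Dom ∧ (∀ n, ∀ y ∈ g n, n ≤ y) ∧
  Partrec σ ∧ D ⊆ σ.Dom ∧ ∀ n ∈ D, ∀ S ∈ σ n, ∀ b ∈ g n, S.card < b

/-- The `(D, g)`-trace `σ` traces `f`: `f n ∈ σ n` for all but finitely many `n ∈ D`. -/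
def DGTraces (D : Set ℕ) (σ : ℕ →. Finset ℕ) (f : ℕ → ℕ) : Prop :=
  ∀ᶠ n in atTop, n ∈ D → ∀ S ∈ σ n, f n ∈ S

/-- The first `s` values of the characteristic function of the oracle `A`. -/
noncomputable def oracleSegment (A : Set ℕ) (s : ℕ) : List ℕ :=
  (List.range s).map (A.indicator fun _ => 1)

@[simp]
lemma length_oracleSegment (A : Set ℕ) (s : ℕ) : (oracleSegment A s).length = s := by
  simp [oracleSegment]

lemma take_oracleSegment (A : Set ℕ) {p s : ℕ} (h : p ≤ s) :
    (oracleSegment A s).take p = oracleSegment A p := by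
  simp [oracleSegment, ← List.map_take, List.take_range, h]

/-- The least `n < k` with `T n = true`, if there is one. -/
def firstBelow (T : ℕ → Bool) (k : ℕ) : Option ℕ := (List.range k).find? T

lemma firstBelow_eq_some {T : ℕ → Bool} {k n : ℕ} :
    firstBelow T k = some n ↔ n < k ∧ T n = true ∧ ∀ m < n, T m = false := by
  simp [firstBelow, List.find?_range_eq_some]
  tauto

lemma primrec_firstBelow {α : Type} [Primcodable α] {T : α → ℕ → Bool} {k : α → ℕ}
    (hT : Primrec₂ T) (hk : Primrec k) : Primrec fun a => firstBelow (T a) (k a) := by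
  have h := Primrec.nat_rec' (h := fun a (p : ℕ × Option ℕ) =>
      (p.2 <|> bif T a p.1 then some p.1 else none)) hk (Primrec.const (none : Option ℕ))
    (Primrec.option_orElse.comp (Primrec.snd.comp Primrec.snd)
      (Primrec.cond (hT.comp Primrec.fst (Primrec.fst.comp Primrec.snd))
        (Primrec.option_some.comp (Primrec.fst.comp Primrec.snd)) (Primrec.const none))).to₂
  refine h.of_eq fun a => ?_
  induction k a with
  | zero => rfl
  | succ n ih =>
    simp only [ih, firstBelow, List.range_succ, List.find?_append]
    cases h : T a n <;> simp [h]

/-- `F` approximates the partial function `f` along the initial segments of `A`. -/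
structure Approximates (A : Set ℕ) (F : List ℕ → ℕ → Option ℕ) (f : ℕ →. ℕ) : Prop where
  mono : ∀ {s t n y}, s ≤ t → F (oracleSegment A s) n = some y →
    F (oracleSegment A t) n = some y
  mem_iff : ∀ {n y}, y ∈ f n ↔ ∃ s, F (oracleSegment A s) n = some y

lemma indicator_part_eq_some (A : Set ℕ) (n : ℕ) :
    A.indicator (fun _ => (1 : Part ℕ)) n = Part.some (A.indicator (fun _ => 1) n) := by
  by_cases h : n ∈ A
  · simp only [Set.indicator_of_mem h]
    rfl
  · simp only [Set.indicator_of_notMem h]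
    rfl

/-- Every function recursive in `A` has a primitive recursive approximation along `A`. -/
theorem RecursiveIn.exists_approximates {A : Set ℕ} {f : ℕ →. ℕ} (hf : RecursiveIn A f) :
    ∃ F, Primrec₂ F ∧ Approximates A F f := by
  induction hf with
  | zero =>
    refine ⟨fun _ _ => some 0, Primrec.const _, fun _ h => h, ?_⟩
    intro n y
    change y ∈ Part.some 0 ↔ _
    simp [eq_comm]
  | succ =>
    refine ⟨fun _ n => some n.succ, Primrec.option_some.comp (Primrec.succ.comp Primrec.snd),
      fun _ h => h, ?_⟩
    simp [eq_comm]
  | left =>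
    refine ⟨fun _ n => some n.unpair.1, Primrec.option_some.comp
      (Primrec.fst.comp (Primrec.unpair.comp Primrec.snd)), fun _ h => h, ?_⟩
    simp [eq_comm]
  | right =>
    refine ⟨fun _ n => some n.unpair.2, Primrec.option_some.comp
      (Primrec.snd.comp (Primrec.unpair.comp Primrec.snd)), fun _ h => h, ?_⟩
    simp [eq_comm]
  | oracle =>
    have key : ∀ s n y, (oracleSegment A s)[n]? = some y ↔
        n < s ∧ A.indicator (fun _ => 1) n = y := by
      intro s n y
      simp [oracleSegment, List.getElem?_eq_some_iff]
    refine ⟨fun σ n => σ[n]?, Primrec.list_getElem?, ?_, ?_⟩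
    · intro s t n y hst h
      rw [key] at h ⊢
      exact ⟨h.1.trans_le hst, h.2⟩
    · intro n y
      simp only [key, indicator_part_eq_some, Part.mem_some_iff]
      exact ⟨fun h => ⟨n + 1, by omega, h.symm⟩, fun ⟨_, _, h⟩ => h.symm⟩
  | @pair f g _ _ ihf ihg =>
    obtain ⟨F, hF, aF⟩ := ihf
    obtain ⟨G, hG, aG⟩ := ihg
    refine ⟨fun σ n => (F σ n).bind fun a => (G σ n).map fun b => Nat.pair a b, ?_, ?_, ?_⟩
    · exact Primrec.option_bind hF (Primrec.option_map (hG.comp (Primrec.fst.comp Primrec.fst)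
        (Primrec.snd.comp Primrec.fst)) (Primrec₂.natPair.comp (Primrec.snd.comp Primrec.fst)
          Primrec.snd).to₂).to₂
    · intro s t n y hst h
      simp only [Option.bind_eq_some_iff, Option.map_eq_some_iff] at h ⊢
      obtain ⟨a, ha, b, hb, rfl⟩ := h
      exact ⟨a, aF.mono hst ha, b, aG.mono hst hb, rfl⟩
    · intro n y
      simp only [Seq.seq, Part.map_eq_map, Part.mem_bind_iff, Part.mem_map_iff,
        Option.bind_eq_some_iff, Option.map_eq_some_iff, aF.mem_iff, aG.mem_iff]
      constructor
      · rintro ⟨_, ⟨a, ⟨s, ha⟩, rfl⟩, b, ⟨t, hb⟩, rfl⟩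
        exact ⟨max s t, a, aF.mono (le_max_left _ _) ha, b, aG.mono (le_max_right _ _) hb, rfl⟩
      · rintro ⟨s, a, ha, b, hb, rfl⟩
        exact ⟨_, ⟨a, ⟨s, ha⟩, rfl⟩, b, ⟨s, hb⟩, rfl⟩
  | @comp f g _ _ ihf ihg =>
    obtain ⟨F, hF, aF⟩ := ihf
    obtain ⟨G, hG, aG⟩ := ihg
    refine ⟨fun σ n => (G σ n).bind fun a => F σ a, ?_, ?_, ?_⟩
    · exact Primrec.option_bind hG (hF.comp (Primrec.fst.comp Primrec.fst) Primrec.snd).to₂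
    · intro s t n y hst h
      simp only [Option.bind_eq_some_iff] at h ⊢
      obtain ⟨a, ha, hb⟩ := h
      exact ⟨a, aG.mono hst ha, aF.mono hst hb⟩
    · intro n y
      refine Part.mem_bind_iff.trans ?_
      simp only [Option.bind_eq_some_iff, aF.mem_iff,
        aG.mem_iff]
      constructor
      · rintro ⟨a, ⟨s, ha⟩, t, hb⟩
        exact ⟨max s t, a, aG.mono (le_max_left _ _) ha, aF.mono (le_max_right _ _) hb⟩
      · rintro ⟨s, a, ha, hb⟩
        exact ⟨a, ⟨s, ha⟩, s, hb⟩
  | @prec f g _ _ ihf ihg =>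
    obtain ⟨F, hF, aF⟩ := ihf
    obtain ⟨G, hG, aG⟩ := ihg
    let R : List ℕ → ℕ → ℕ → Option ℕ := fun σ a k =>
      k.rec (F σ a) fun y r => r.bind fun i => G σ (Nat.pair a (Nat.pair y i))
    have hR : ∀ σ a k, R σ a (k + 1) =
      (R σ a k).bind fun i => G σ (Nat.pair a (Nat.pair k i)) := fun _ _ _ => rfl
    have mono : ∀ {s t a k y}, s ≤ t → R (oracleSegment A s) a k = some y →
        R (oracleSegment A t) a k = some y := by
      intro s t a k y hst
      induction k generalizing y with
      | zero => exact aF.mono hst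
      | succ k ih =>
        simp only [hR, Option.bind_eq_some_iff]
        rintro ⟨i, hi, h⟩
        exact ⟨i, ih hi, aG.mono hst h⟩
    refine ⟨fun σ n => R σ n.unpair.1 n.unpair.2, ?_, mono, ?_⟩
    · have u : Primrec fun p : List ℕ × ℕ => p.2.unpair := Primrec.unpair.comp Primrec.snd
      refine Primrec.nat_rec' (Primrec.snd.comp u) (hF.comp Primrec.fst (Primrec.fst.comp u))
        (h := fun (p : List ℕ × ℕ) (q : ℕ × Option ℕ) =>
          q.2.bind fun i => G p.1 (Nat.pair p.2.unpair.1 (Nat.pair q.1 i))) ?_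
      refine Primrec.option_bind (Primrec.snd.comp Primrec.snd) ?_
      refine hG.comp (Primrec.fst.comp (Primrec.fst.comp Primrec.fst)) ?_
      refine Primrec₂.natPair.comp
        (Primrec.fst.comp (u.comp (Primrec.fst.comp Primrec.fst))) ?_
      exact Primrec₂.natPair.comp (Primrec.fst.comp (Primrec.snd.comp Primrec.fst)) Primrec.snd
    · intro n y
      simp only [Nat.unpaired]
      generalize n.unpair.1 = a
      generalize n.unpair.2 = k
      induction k generalizing y with
      | zero => exact aF.mem_iff
      | succ k ih =>
        refine Part.mem_bind_iff.trans ?_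
        simp only [hR, ih, aG.mem_iff,
          Option.bind_eq_some_iff]
        constructor
        · rintro ⟨i, ⟨s, hi⟩, t, h⟩
          exact ⟨max s t, i, mono (le_max_left _ _) hi, aG.mono (le_max_right _ _) h⟩
        · rintro ⟨s, i, hi, h⟩
          exact ⟨i, ⟨s, hi⟩, s, h⟩
  | @rfind f _ ihf =>
    obtain ⟨F, hF, aF⟩ := ihf
    -- `halted σ a n` says that `F σ (a, n)` is undefined or zero
    let halted : List ℕ × ℕ → ℕ → Bool := fun p n =>
      decide ((F p.1 (Nat.pair p.2 n)).getD 0 = 0)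
    have halted_false : ∀ p n, halted p n = false ↔ ∃ y, F p.1 (Nat.pair p.2 n) = some (y + 1) := by
      intro p n
      simp only [halted]
      cases F p.1 (Nat.pair p.2 n) with
      | none => simp
      | some y => cases y <;> simp
    let R : List ℕ → ℕ → Option ℕ := fun σ a =>
      (firstBelow (halted (σ, a)) σ.length).bind fun n =>
        (F σ (Nat.pair a n)).bind fun y => bif decide (y = 0) then some n else none
    have hR : ∀ s a n, R (oracleSegment A s) a = some n ↔ n < s ∧
        F (oracleSegment A s) (Nat.pair a n) = some 0 ∧
        ∀ m < n, ∃ y, F (oracleSegment A s) (Nat.pair a m) = some (y + 1) := by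
      intro s a n
      simp only [R, Option.bind_eq_some_iff, firstBelow_eq_some, halted_false,
        length_oracleSegment]
      constructor
      · rintro ⟨n', ⟨h₁, -, h₂⟩, y, hy, h⟩
        rcases y with _ | y
        · obtain rfl : n' = n := by simpa using h
          exact ⟨h₁, hy, h₂⟩
        · simp at h
      · rintro ⟨h₁, h₂, h₃⟩
        exact ⟨n, ⟨h₁, by simp [halted, h₂], h₃⟩, 0, h₂, rfl⟩
    have mono : ∀ {s t a y}, s ≤ t → R (oracleSegment A s) a = some y →
        R (oracleSegment A t) a = some y := by
      intro s t a n hst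
      rw [hR, hR]
      rintro ⟨h₁, h₂, h₃⟩
      exact ⟨h₁.trans_le hst, aF.mono hst h₂, fun m hm => (h₃ m hm).imp fun y => aF.mono hst⟩
    refine ⟨R, ?_, mono, ?_⟩
    · have halted_primrec : Primrec₂ halted := by
        refine (Primrec.eq.comp (Primrec.option_getD.comp (hF.comp
          (Primrec.fst.comp Primrec.fst) (Primrec₂.natPair.comp
          (Primrec.snd.comp Primrec.fst) Primrec.snd)) (Primrec.const 0))
          (Primrec.const 0)).decide.of_eq fun p => rfl
      refine Primrec.option_bind (primrec_firstBelow halted_primrec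
        (Primrec.list_length.comp Primrec.fst)) ?_
      refine Primrec.option_bind (hF.comp (Primrec.fst.comp Primrec.fst)
        (Primrec₂.natPair.comp (Primrec.snd.comp Primrec.fst) Primrec.snd)) ?_
      exact Primrec.cond ((Primrec.eq.comp Primrec.snd (Primrec.const 0)).decide)
        (Primrec.option_some.comp (Primrec.snd.comp Primrec.fst)) (Primrec.const none)
    · intro a n
      refine Nat.mem_rfind.trans ?_
      simp only [hR, Part.map_eq_map, Part.mem_map_iff, aF.mem_iff]
      constructor
      · rintro ⟨⟨y, ⟨s, hs⟩, hy⟩, h⟩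
        obtain rfl : y = 0 := by simpa using hy
        have h' : ∀ m, ∃ t, m < n →
            ∃ y, F (oracleSegment A t) (Nat.pair a m) = some (y + 1) := by
          intro m
          by_cases hm : m < n
          · obtain ⟨y, ⟨t, ht⟩, hy⟩ := h hm
            obtain ⟨y, rfl⟩ := Nat.exists_eq_succ_of_ne_zero (by simpa using hy : y ≠ 0)
            exact ⟨t, fun _ => ⟨y, ht⟩⟩
          · exact ⟨0, fun h => absurd h hm⟩
        choose t ht using h'
        refine ⟨max s (max (n + 1) ((Finset.range n).sup t)), by omega,
          aF.mono (le_max_left _ _) hs, fun m hm => (ht m hm).imp fun y => aF.mono ?_⟩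
        exact (Finset.le_sup (Finset.mem_range.2 hm)).trans
          ((le_max_right _ _).trans (le_max_right _ _))
      · rintro ⟨s, -, h₁, h₂⟩
        refine ⟨⟨0, ⟨s, h₁⟩, by simp⟩, fun {m} hm => ?_⟩
        obtain ⟨y, hy⟩ := h₂ m hm
        exact ⟨y + 1, ⟨s, hy⟩, by simp⟩

lemma RecursiveIn.of_partrec (A : Set ℕ) {f : ℕ →. ℕ} (hf : Nat.Partrec f) :
    RecursiveIn A f := by
  induction hf with
  | zero => exact .zero
  | succ => exact .succ
  | left => exact .left
  | right => exact .right
  | pair _ _ h₁ h₂ => exact .pair h₁ h₂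
  | comp _ _ h₁ h₂ => exact .comp h₁ h₂
  | prec _ _ h₁ h₂ => exact .prec h₁ h₂
  | rfind _ h => exact .rfind h

lemma RecursiveIn.of_primrec (A : Set ℕ) {f : ℕ → ℕ} (hf : Primrec f) :
    RecursiveIn A (f : ℕ →. ℕ) :=
  .of_partrec A (.of_primrec (Primrec.nat_iff.1 hf))

lemma RecursiveIn.of_eq {A : Set ℕ} {f g : ℕ →. ℕ} (hf : RecursiveIn A f)
    (h : ∀ n, f n = g n) : RecursiveIn A g :=
  (funext h : f = g) ▸ hf

lemma RecursiveIn.pair_total {A : Set ℕ} {f g : ℕ → ℕ} (hf : RecursiveIn A (f : ℕ →. ℕ))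
    (hg : RecursiveIn A (g : ℕ →. ℕ)) :
    RecursiveIn A ((fun n => Nat.pair (f n) (g n) : ℕ → ℕ) : ℕ →. ℕ) := by
  refine (RecursiveIn.pair hf hg).of_eq fun n => ?_
  simp [Seq.seq]

lemma RecursiveIn.comp_total {A : Set ℕ} {f g : ℕ → ℕ} (hf : RecursiveIn A (f : ℕ →. ℕ))
    (hg : RecursiveIn A (g : ℕ →. ℕ)) :
    RecursiveIn A ((fun n => f (g n) : ℕ → ℕ) : ℕ →. ℕ) := by
  exact (RecursiveIn.comp hf hg).of_eq fun n => Part.bind_some (g n) _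

lemma RecursiveIn.oracleSegment (A : Set ℕ) :
    RecursiveIn A ((fun s => Encodable.encode (oracleSegment A s) : ℕ → ℕ) : ℕ →. ℕ) := by
  let χ : ℕ → ℕ := fun n => A.indicator (fun _ => 1) n
  have hχ : RecursiveIn A (χ : ℕ →. ℕ) :=
    RecursiveIn.oracle.of_eq (indicator_part_eq_some A)
  let step : ℕ → ℕ := fun n => Encodable.encode
    (Denumerable.ofNat (List ℕ) n.unpair.1 ++ [n.unpair.2])
  have hstep : Primrec step := Primrec.encode.comp (Primrec.list_concat.comp
    ((Primrec.ofNat _).comp (Primrec.fst.comp Primrec.unpair)) (Primrec.snd.comp Primrec.unpair))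
  have hright : RecursiveIn A ((fun n => n.unpair.2 : ℕ → ℕ) : ℕ →. ℕ) := .right
  have hleft : RecursiveIn A ((fun n => n.unpair.1 : ℕ → ℕ) : ℕ →. ℕ) := .left
  have hg := RecursiveIn.comp_total (.of_primrec A hstep)
    (RecursiveIn.pair_total (RecursiveIn.comp_total hright hright)
      (RecursiveIn.comp_total (f := χ) hχ (RecursiveIn.comp_total hleft hright)))
  have hrec := RecursiveIn.prec (.of_primrec A (Primrec.const (Encodable.encode ([] : List ℕ)))) hg
  refine (RecursiveIn.comp hrec (.of_primrec A
    (Primrec₂.natPair.comp (Primrec.const 0) Primrec.id))).of_eq fun s => ?_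
  simp only [PFun.coe_val, Part.bind_eq_bind, Part.bind_some, Nat.unpaired, Nat.unpair_pair, id]
  induction s with
  | zero => rfl
  | succ s ih =>
    simp only [ih, Part.bind_some]
    simp [step, χ, CichonAnalog.oracleSegment, List.range_succ]

/-- A total function with a consistent primitive recursive approximation along `A` is
recursive in `A`. -/
theorem RecursiveIn.of_approximation {A : Set ℕ} {F : List ℕ → ℕ → Option ℕ} {x : ℕ → ℕ}
    (hF : Primrec₂ F) (ex : ∀ n, ∃ s, F (CichonAnalog.oracleSegment A s) n = some (x n))
    (uniq : ∀ {n s y}, F (CichonAnalog.oracleSegment A s) n = some y → y = x n) :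
    RecursiveIn A (x : ℕ →. ℕ) := by
  let val : ℕ → Option ℕ := fun p => F (Denumerable.ofNat (List ℕ) p.unpair.2) p.unpair.1
  have hval : Primrec val := hF.comp
    ((Primrec.ofNat _).comp (Primrec.snd.comp Primrec.unpair)) (Primrec.fst.comp Primrec.unpair)
  have hundef : Primrec fun p => (val p).casesOn (motive := fun _ => ℕ) 1 fun _ => 0 :=
    Primrec.option_casesOn hval (Primrec.const 1) (Primrec.const 0).to₂
  have hget : Primrec fun p => (val p).getD 0 :=
    Primrec.option_getD.comp hval (Primrec.const 0)
  have hright : RecursiveIn A ((fun n => n.unpair.2 : ℕ → ℕ) : ℕ →. ℕ) := .right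
  have hleft : RecursiveIn A ((fun n => n.unpair.1 : ℕ → ℕ) : ℕ →. ℕ) := .left
  have hseg := RecursiveIn.pair_total hleft
    (RecursiveIn.comp_total (RecursiveIn.oracleSegment A) hright)
  have hfind := RecursiveIn.rfind (RecursiveIn.comp_total (.of_primrec A hundef) hseg)
  have hid : RecursiveIn A ((fun n => n : ℕ → ℕ) : ℕ →. ℕ) := .of_primrec A Primrec.id
  refine (RecursiveIn.comp (RecursiveIn.comp_total (.of_primrec A hget) hseg)
    (RecursiveIn.pair hid hfind)).of_eq fun n => Part.eq_some_iff.2 ?_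
  refine Part.mem_bind_iff.2 ?_
  simp only [Seq.seq, Part.map_eq_map, Part.mem_map_iff, PFun.coe_val, Part.map_some,
    Part.bind_some, Part.mem_some_iff]
  have hdom : ∃ s, s ∈ Nat.rfind fun s => Part.some (decide
      ((val (Nat.pair n (Encodable.encode (CichonAnalog.oracleSegment A s)))).casesOn
        (motive := fun _ => ℕ) 1 (fun _ => 0) = 0)) := by
    obtain ⟨s, hs⟩ := ex n
    obtain ⟨m, hm, -⟩ := Nat.rfind_min' (p := fun s => decide
      ((val (Nat.pair n (Encodable.encode (CichonAnalog.oracleSegment A s)))).casesOn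
        (motive := fun _ => ℕ) 1 (fun _ => 0) = 0)) (m := s) (by simp [val, hs])
    exact ⟨m, hm⟩
  obtain ⟨s, hs⟩ := hdom
  refine ⟨Nat.pair n s, ⟨s, by simpa using hs, rfl⟩, ?_⟩
  have h := Nat.rfind_spec hs
  cases hv : F (CichonAnalog.oracleSegment A s) n with
  | none => simp [val, hv] at h
  | some y => simp [val, hv, uniq hv]

/-! ### The effective Baire category theorem relative to an oracle -/

lemma mem_cyl_iff {σ : List Bool} {x : ℕ → Bool} :
    x ∈ Cyl σ ↔ (List.range σ.length).map x = σ := by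
  constructor
  · intro h
    refine List.ext_getElem (by simp) fun i h₁ h₂ => ?_
    rw [List.getElem_map, List.getElem_range, h i h₂, List.getD_eq_getElem _ _ h₂]
  · intro h i hi
    rw [List.getD_eq_getElem _ _ hi]
    have : ((List.range σ.length).map x)[i]? = σ[i]? := by rw [h]
    simpa [hi, List.getElem?_eq_getElem hi] using this

lemma cyl_anti {σ τ : List Bool} (h : σ <+: τ) : Cyl τ ⊆ Cyl σ := by
  intro x hx i hi
  rw [hx i (hi.trans_le h.length_le), List.getD_eq_getElem _ _ hi,
    List.getD_eq_getElem _ _ (hi.trans_le h.length_le), h.getElem hi]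

lemma isOpen_cyl (σ : List Bool) : IsOpen (Cyl σ) := by
  have : Cyl σ = ⋂ i ∈ Finset.range σ.length, (fun x : ℕ → Bool => x i) ⁻¹' {σ.getD i false} := by
    ext x
    simp [Cyl]
  rw [this]
  exact isOpen_biInter_finset fun i _ => (isOpen_discrete _).preimage (continuous_apply i)

lemma cyl_nonempty (σ : List Bool) : (Cyl σ).Nonempty :=
  ⟨fun i => σ.getD i false, fun _ _ => rfl⟩

/-- If the closed class avoiding the cylinders of `W` is nowhere dense, then every string can be
extended to an extension of some member of `W`. -/
lemma exists_append_eq_append_of_isNowhereDense {W : Set (List Bool)}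
    (h : IsNowhereDense (⋃ σ ∈ W, Cyl σ)ᶜ) (τ : List Bool) :
    ∃ ρ, ∃ σ ∈ W, ∃ κ, τ ++ ρ = σ ++ κ := by
  have hnot : ¬ Cyl τ ⊆ (⋃ σ ∈ W, Cyl σ)ᶜ := by
    intro hsub
    obtain ⟨x, hx⟩ := cyl_nonempty τ
    have : x ∈ interior (closure (⋃ σ ∈ W, Cyl σ)ᶜ) :=
      interior_maximal (hsub.trans subset_closure) (isOpen_cyl τ) hx
    rw [h] at this
    exact this
  obtain ⟨x, hxτ, hx⟩ := Set.not_subset.1 hnot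
  obtain ⟨σ, hσ, hxσ⟩ : ∃ σ ∈ W, x ∈ Cyl σ := by simpa using hx
  have hp : ∀ υ : List Bool, x ∈ Cyl υ → υ.length ≤ max τ.length σ.length →
      υ <+: (List.range (max τ.length σ.length)).map x := by
    intro υ hυ hl
    rw [← mem_cyl_iff.1 hυ]
    simpa [← List.map_take, List.take_range, hl] using
      List.take_prefix υ.length ((List.range (max τ.length σ.length)).map x)
  obtain ⟨ρ, hρ⟩ := hp τ hxτ (le_max_left _ _)
  obtain ⟨κ, hκ⟩ := hp σ hxσ (le_max_right _ _)
  exact ⟨ρ, σ, hσ, κ, hρ.trans hκ.symm⟩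

/-- The triple of strings coded by the first component of `q`; the second component of `q` only
serves to make `q` large. -/
def witness (q : ℕ) : List Bool × List Bool × List Bool :=
  (Encodable.decode q.unpair.1).getD ([], [], [])

/-- `q` codes `(ρ, σ, κ)` with `τ ++ ρ = σ ++ κ` and `F` accepts `(m, σ)` with the first `q`
oracle bits. -/
def isWitness (F : List ℕ → ℕ → Option ℕ) (α : List ℕ) (m : ℕ) (τ : List Bool) (q : ℕ) : Bool :=
  decide (τ ++ (witness q).1 = (witness q).2.1 ++ (witness q).2.2) &&
    (F (α.take q) (Encodable.encode (m, (witness q).2.1))).isSome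

/-- The `m`-th string of the construction of a point avoiding the classes described by `F`, as far
as it can be found from the finite oracle string `α`. -/
def genericStage (F : List ℕ → ℕ → Option ℕ) (α : List ℕ) (m : ℕ) : Option (List Bool) :=
  m.rec (some []) fun m r => r.bind fun τ =>
    (firstBelow (isWitness F α m τ) α.length).map fun q => (τ ++ (witness q).1) ++ [false]

lemma genericStage_succ_eq_some {F : List ℕ → ℕ → Option ℕ} {α : List ℕ} {m : ℕ}
    {υ : List Bool} : genericStage F α (m + 1) = some υ ↔
      ∃ τ, genericStage F α m = some τ ∧
        ∃ q, firstBelow (isWitness F α m τ) α.length = some q ∧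
          (τ ++ (witness q).1) ++ [false] = υ := by
  change ((genericStage F α m).bind _) = _ ↔ _
  simp only [Option.bind_eq_some_iff, Option.map_eq_some_iff]

lemma primrec_witness : Primrec witness :=
  Primrec.option_getD.comp (Primrec.decode.comp (Primrec.fst.comp Primrec.unpair))
    (Primrec.const _)

lemma primrec_genericStage {F : List ℕ → ℕ → Option ℕ} (hF : Primrec₂ F) :
    Primrec₂ (genericStage F) := by
  have hT : Primrec₂ fun (p : (List ℕ × ℕ) × List Bool) (q : ℕ) =>
      isWitness F p.1.1 p.1.2 p.2 q := by
    have w : Primrec fun p : ((List ℕ × ℕ) × List Bool) × ℕ => witness p.2 :=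
      primrec_witness.comp Primrec.snd
    refine Primrec.and.comp ?_ ?_
    · exact (Primrec.eq.comp
        (Primrec.list_append.comp (Primrec.snd.comp Primrec.fst) (Primrec.fst.comp w))
        (Primrec.list_append.comp (Primrec.fst.comp (Primrec.snd.comp w))
          (Primrec.snd.comp (Primrec.snd.comp w)))).decide
    · refine Primrec.option_isSome.comp (hF.comp ?_ ?_)
      · exact Primrec.list_take.comp Primrec.snd
          (Primrec.fst.comp (Primrec.fst.comp Primrec.fst))
      · exact Primrec.encode.comp (Primrec.pair
          (Primrec.snd.comp (Primrec.fst.comp Primrec.fst))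
          (Primrec.fst.comp (Primrec.snd.comp w)))
  refine Primrec.nat_rec (f := fun _ => some []) (g := fun (α : List ℕ) (p : ℕ × Option _) =>
    p.2.bind fun τ => (firstBelow (isWitness F α p.1 τ) α.length).map
      fun q => (τ ++ (witness q).1) ++ [false]) (Primrec.const _) ?_
  refine Primrec.option_bind (Primrec.snd.comp Primrec.snd) ?_
  refine Primrec.option_map (primrec_firstBelow (hT.comp
      (Primrec.pair (Primrec.pair (Primrec.fst.comp (Primrec.fst.comp Primrec.fst))
        (Primrec.fst.comp (Primrec.snd.comp (Primrec.fst.comp Primrec.fst))))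
        (Primrec.snd.comp Primrec.fst)) Primrec.snd)
      (Primrec.list_length.comp (Primrec.fst.comp Primrec.fst))) ?_
  exact Primrec.list_append.comp (Primrec.list_append.comp (Primrec.snd.comp Primrec.fst)
    (Primrec.fst.comp (primrec_witness.comp Primrec.snd))) (Primrec.const _)

lemma isWitness_oracleSegment (F : List ℕ → ℕ → Option ℕ) (A : Set ℕ) {m q s : ℕ}
    {τ : List Bool} (h : q ≤ s) : isWitness F (oracleSegment A s) m τ q =
      isWitness F (oracleSegment A q) m τ q := by
  simp only [isWitness, take_oracleSegment A h, take_oracleSegment A le_rfl]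

lemma genericStage_mono {F : List ℕ → ℕ → Option ℕ} {A : Set ℕ} {s t m : ℕ} {τ : List Bool}
    (hst : s ≤ t) (h : genericStage F (oracleSegment A s) m = some τ) :
    genericStage F (oracleSegment A t) m = some τ := by
  induction m generalizing τ with
  | zero => exact h
  | succ m ih =>
    rw [genericStage_succ_eq_some] at h ⊢
    obtain ⟨υ, hυ, q, hq, rfl⟩ := h
    refine ⟨υ, ih hυ, q, ?_, rfl⟩
    rw [firstBelow_eq_some, length_oracleSegment] at hq ⊢
    refine ⟨by omega, ?_, fun p hp => ?_⟩
    · rw [isWitness_oracleSegment F A (by omega), ← isWitness_oracleSegment F A hq.1.le]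
      exact hq.2.1
    · rw [isWitness_oracleSegment F A (by omega),
        ← isWitness_oracleSegment F A (by omega : p ≤ s)]
      exact hq.2.2 p hp

lemma genericStage_unique {F : List ℕ → ℕ → Option ℕ} {A : Set ℕ} {s t m : ℕ}
    {τ υ : List Bool} (h₁ : genericStage F (oracleSegment A s) m = some τ)
    (h₂ : genericStage F (oracleSegment A t) m = some υ) : τ = υ :=
  Option.some_injective _ ((genericStage_mono (le_max_left s t) h₁).symm.trans
    (genericStage_mono (le_max_right s t) h₂))

lemma exists_genericStage {F : List ℕ → ℕ → Option ℕ} {A : Set ℕ}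
    (mono : ∀ {s t n y}, s ≤ t → F (oracleSegment A s) n = some y →
      F (oracleSegment A t) n = some y)
    (ext : ∀ m τ, ∃ ρ σ κ s, τ ++ ρ = σ ++ κ ∧
      (F (oracleSegment A s) (Encodable.encode ((m, σ) : ℕ × List Bool))).isSome) (m : ℕ) :
    ∃ s τ, genericStage F (oracleSegment A s) m = some τ := by
  induction m with
  | zero => exact ⟨0, [], rfl⟩
  | succ m ih =>
    obtain ⟨s, τ, hs⟩ := ih
    have hw : ∃ q, isWitness F (oracleSegment A q) m τ q = true := by
      obtain ⟨ρ, σ, κ, t, h₁, h₂⟩ := ext m τ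
      obtain ⟨y, hy⟩ := Option.isSome_iff_exists.1 h₂
      refine ⟨Nat.pair (Encodable.encode (ρ, σ, κ)) t, ?_⟩
      have hw : witness (Nat.pair (Encodable.encode (ρ, σ, κ)) t) = (ρ, σ, κ) := by
        rw [witness, Nat.unpair_pair, Encodable.encodek, Option.getD_some]
      rw [isWitness, hw, take_oracleSegment A le_rfl, mono (Nat.right_le_pair _ _) hy]
      simp [h₁]
    refine ⟨max s (Nat.find hw + 1), _, genericStage_succ_eq_some.2
      ⟨τ, genericStage_mono (le_max_left _ _) hs, Nat.find hw, ?_, rfl⟩⟩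
    rw [firstBelow_eq_some, length_oracleSegment]
    refine ⟨by omega, ?_, fun p hp => ?_⟩
    · rw [isWitness_oracleSegment F A (by omega)]
      exact Nat.find_spec hw
    · rw [isWitness_oracleSegment F A (by omega)]
      simpa using Nat.find_min hw hp

/-- Relativized effective Baire category theorem: no set that is effectively meager relative to
`A` contains every `A`-computable point. -/
theorem EffMeagerIn.exists_computableIn_notMem {A : Set ℕ} {S : Set (ℕ → Bool)}
    (hS : EffMeagerIn A S) : ∃ x : ℕ → Bool, ComputableIn A x ∧ x ∉ S := by
  obtain ⟨C, ⟨W, ⟨f, hf, hW⟩, hC⟩, hnd, hSC⟩ := hS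
  obtain ⟨F, hF, aF⟩ := RecursiveIn.exists_approximates hf
  have mem_W : ∀ p, p ∈ W ↔ ∃ s, (F (oracleSegment A s) (Encodable.encode p)).isSome := by
    intro p
    simp only [hW, Part.dom_iff_mem, Option.isSome_iff_exists]
    rw [exists_comm]
    simp [← aF.mem_iff, ← Part.dom_iff_mem]
  have hext : ∀ m τ, ∃ ρ σ κ s, τ ++ ρ = σ ++ κ ∧
      (F (oracleSegment A s) (Encodable.encode ((m, σ) : ℕ × List Bool))).isSome := by
    intro m τ
    obtain ⟨ρ, σ, hσ, κ, h⟩ := exists_append_eq_append_of_isNowhereDense (hC m ▸ hnd m) τ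
    obtain ⟨s, hs⟩ := (mem_W (m, σ)).1 hσ
    exact ⟨ρ, σ, κ, s, h, hs⟩
  choose s G hG using exists_genericStage aF.mono hext
  have step : ∀ m, ∃ ρ σ κ, G (m + 1) = (G m ++ ρ) ++ [false] ∧ G m ++ ρ = σ ++ κ ∧
      (m, σ) ∈ W := by
    intro m
    obtain ⟨τ, hτ, q, hq, hG'⟩ := genericStage_succ_eq_some.1 (hG (m + 1))
    obtain rfl := genericStage_unique hτ (hG m)
    have hq' := (firstBelow_eq_some.1 hq).2.1
    rw [length_oracleSegment, firstBelow_eq_some] at hq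
    simp only [isWitness, Bool.and_eq_true, decide_eq_true_eq] at hq'
    rw [take_oracleSegment A hq.1.le] at hq'
    exact ⟨_, _, _, hG'.symm, hq'.1, (mem_W _).2 ⟨q, hq'.2⟩⟩
  have prefix_succ : ∀ m, G m <+: G (m + 1) := by
    intro m
    obtain ⟨ρ, _, _, h, -⟩ := step m
    exact ⟨ρ ++ [false], by simp [h]⟩
  have prefix_le : ∀ {m n}, m ≤ n → G m <+: G n := by
    intro m n h
    induction n, h using Nat.le_induction with
    | base => exact List.prefix_rfl
    | succ n _ ih => exact ih.trans (prefix_succ n)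
  have length_le : ∀ m, m ≤ (G m).length := by
    intro m
    induction m with
    | zero => exact Nat.zero_le _
    | succ m ih =>
      obtain ⟨ρ, _, _, h, -⟩ := step m
      simp only [h, List.length_append, List.length_singleton]
      omega
  let x : ℕ → Bool := fun n => (G (n + 1)).getD n false
  have x_mem : ∀ m, x ∈ Cyl (G m) := by
    intro m i hi
    have hi' : i < (G (i + 1)).length := length_le (i + 1)
    simp only [x]
    rw [List.getD_eq_getElem _ _ hi, List.getD_eq_getElem _ _ hi']
    rcases le_total m (i + 1) with h | h
    · exact ((prefix_le h).getElem hi).symm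
    · exact (prefix_le h).getElem hi'
  refine ⟨x, ?_, fun hxS => ?_⟩
  · have hx := RecursiveIn.of_approximation (A := A)
      (F := fun α n => (genericStage F α (n + 1)).map fun τ => Encodable.encode (τ.getD n false))
      (x := fun n => Encodable.encode (x n)) ?_ ?_ ?_
    · exact hx.of_eq fun n => by simp
    · exact Primrec.option_map ((primrec_genericStage hF).comp Primrec.fst
        (Primrec.succ.comp Primrec.snd)) (Primrec.encode.comp ((Primrec.list_getD false).comp
        Primrec.snd (Primrec.snd.comp Primrec.fst)))
    · exact fun n => ⟨s (n + 1), by simp [hG, x]⟩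
    · intro n t y h
      obtain ⟨τ, hτ, rfl⟩ := Option.map_eq_some_iff.1 h
      rw [genericStage_unique hτ (hG (n + 1))]
  · obtain ⟨m, hm⟩ := Set.mem_iUnion.1 (hSC hxS)
    obtain ⟨ρ, σ, κ, h₁, h₂, h₃⟩ := step m
    rw [hC] at hm
    refine hm (Set.mem_biUnion (show σ ∈ {s | (m, s) ∈ W} from h₃) (cyl_anti ?_ (x_mem (m + 1))))
    exact ⟨κ ++ [false], by simp [h₁, h₂]⟩

/-- if `A` is meager engulfing then `A` computes a weakly 1-generic
element of Cantor space (an element belonging to no effectively meager set). -/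
theorem stmt13 (A : Set ℕ) (h : MeagerEngulfing A) :
    ∃ x : ℕ → Bool, ComputableIn A x ∧ ∀ S, EffMeager S → x ∉ S := by
  obtain ⟨S, hS, hT⟩ := h
  obtain ⟨x, hx, hxS⟩ := hS.exists_computableIn_notMem
  exact ⟨x, hx, fun T hTm hxT => hxS (hT T hTm hxT)⟩

end CichonAnalog
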